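/- For every positive integer r there exists a constant C(r) > 0 with the following property: for every odd prime q, every positive integer h with r ≤ h < q, and every real g with 1 ≤ g ≤ q, one has |Σ_{m=1}^{⌊g⌋} S_h(m,q)^{2r−1}| ≤ C(r)·h^{2r−1}·q^{1/2}·log q. -/

import Mathlib

open scoped Classical

noncomputable section

/-- `S h x q = ∑_{x < n ≤ x + h} (n/q)`, where `(n/q)` is the Legendre symbol
(realized by the Jacobi symbol, which agrees with it for prime `q`). -/
def S (h : ℕ) (x : ℝ) (q : ℕ) : ℤ :=
  ∑ j ∈ Finset.Icc 1 h, jacobiSym (⌊x⌋ + j) q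

open Polynomial in
/-- Bombieri's form of Stepanov's method, for the curve `y² = F(x)` with `F` of odd degree. -/
theorem two_mul_card_eval_pow_eq_le {K : Type*} [Field K] [Fintype K] (p m : ℕ) [Fact p.Prime]
    [CharP K p] {t E : ℕ} (hs : 2 * t + 1 = p ^ m) (hq : Fintype.card K = (2 * t + 1) ^ 2)
    (F : K[X]) (hF : F.natDegree = 2 * E + 1) (ht : 2 * E ^ 2 + 4 * E + 1 < t) (ε : K) :
    2 * (Finset.univ.filter fun x : K ↦ F.eval x ^ (2 * t ^ 2 + 2 * t) = ε).card
      ≤ (2 * t + 1) ^ 2 + 4 * (2 * E + 1) * (2 * t + 1) := by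
  set s := 2 * t + 1 with hsdef
  have hF0 : F ≠ 0 := by rintro rfl; simp at hF
  let ι := Fin (t + E + 1) × Fin (t - E) × Bool
  let N : Bool → ℕ := fun β ↦ if β then t + 1 else 0
  let M : ℕ := s * (t - E - 1) + (t + E + 1) + (2 * E + 1) * (t + 1)
  let δ : (ι → K) → K[X] := fun c ↦ ∑ k : ι,
    C (c k ^ s) * (X ^ (k.1 + s * k.2.1 : ℕ) * (C (if k.2.2 then ε else 1) * F ^ N k.2.2))
  let e : ι → K[X] := fun k ↦ X ^ (s * k.1 + k.2.1 : ℕ) * F ^ N k.2.2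
  have he0 : ∀ k, e k ≠ 0 := fun k ↦ mul_ne_zero (pow_ne_zero _ X_ne_zero) (pow_ne_zero _ hF0)
  have hedeg : ∀ k, (e k).natDegree = s * k.1 + k.2.1 + N k.2.2 * (2 * E + 1) := by
    intro k
    simp only [e]
    rw [natDegree_mul (pow_ne_zero _ X_ne_zero) (pow_ne_zero _ hF0), natDegree_X_pow,
      natDegree_pow, hF]
  have hδdeg : ∀ c, (δ c).degree < M := by
    intro c
    refine lt_of_le_of_lt (degree_sum_le _ _) ?_
    rw [Finset.sup_lt_iff (WithBot.bot_lt_coe _)]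
    rintro ⟨j, i, β⟩ -
    have hj := j.2
    have hi := i.2
    refine lt_of_le_of_lt (degree_le_natDegree) ?_
    have h1 : (C (c (j, i, β) ^ s) * (X ^ (j + s * i : ℕ) *
        (C (if β then ε else 1) * F ^ N β))).natDegree ≤ (j + s * i : ℕ) + N β * (2 * E + 1) := by
      refine (natDegree_C_mul_le _ _).trans (natDegree_mul_le.trans ?_)
      rw [natDegree_X_pow]
      gcongr
      refine (natDegree_C_mul_le _ _).trans ?_
      rw [natDegree_pow, hF]
    have h2 : N β ≤ t + 1 := by simp only [N]; split_ifs <;> omega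
    have h3 : N β * (2 * E + 1) ≤ (t + 1) * (2 * E + 1) := Nat.mul_le_mul_right _ h2
    have h4 : s * i ≤ s * (t - E - 1) := Nat.mul_le_mul_left _ (by omega)
    refine lt_of_le_of_lt (WithBot.coe_le_coe.mpr h1) (WithBot.coe_lt_coe.mpr ?_)
    simp only [M]
    nlinarith
  have hcard : Fintype.card (Fin M → K) < Fintype.card (ι → K) := by
    simp only [Fintype.card_fun, Fintype.card_fin, ι, Fintype.card_prod, Fintype.card_bool]
    apply Nat.pow_lt_pow_right Fintype.one_lt_card
    simp only [M]
    have hEt : E < t := by nlinarith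
    obtain ⟨u, rfl⟩ : ∃ u, t = E + 1 + u := ⟨t - E - 1, by omega⟩
    have e1 : E + 1 + u - E = u + 1 := by omega
    rw [e1, hsdef]
    simp only [Nat.add_sub_cancel]
    nlinarith
  obtain ⟨c₁, c₂, hne, heq⟩ := Fintype.exists_ne_map_eq_of_card_lt
    (fun c (i : Fin M) ↦ (δ c).coeff i) hcard
  let c := c₁ - c₂
  have hc0 : c ≠ 0 := sub_ne_zero.mpr hne
  have hδ : δ c = 0 := by
    have h1 : δ c = δ c₁ - δ c₂ := by
      simp only [δ, c, ← Finset.sum_sub_distrib, ← sub_mul, ← C_sub, Pi.sub_apply]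
      rw [hs]
      simp only [sub_pow_char_pow]
    rw [h1]
    ext i
    by_cases hi : i < M
    · simpa [sub_eq_zero] using congrFun heq ⟨i, hi⟩
    · have hi' : (M : WithBot ℕ) ≤ i := by exact_mod_cast not_lt.mp hi
      simp [coeff_eq_zero_of_degree_lt ((hδdeg _).trans_le hi')]
  let H : K[X] := ∑ k, C (c k) * e k
  have hH0 : H ≠ 0 := by
    intro hH
    apply hc0
    funext k
    have hdeg := degree_sum_eq_of_disjoint (fun k ↦ C (c k) * e k) Finset.univ (by
      rintro ⟨j, i, β⟩ ⟨-, h1⟩ ⟨j', i', β'⟩ ⟨-, h2⟩ hne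
      have h1' : c (j, i, β) ≠ 0 := by rintro h; simp [h] at h1
      have h2' : c (j', i', β') ≠ 0 := by rintro h; simp [h] at h2
      simp only [Function.onFun, Function.comp, ne_eq]
      rw [degree_C_mul h1', degree_C_mul h2', degree_eq_natDegree (he0 _),
        degree_eq_natDegree (he0 _), hedeg, hedeg]
      intro h
      norm_cast at h
      have hi := i.2
      have hi' := i'.2
      apply hne
      have key : ∀ j i : ℕ, ∀ β, s * j + i + N β * (2 * E + 1) =
          s * (j + if β then E else 0) + (i + if β then E + t + 1 else 0) := by
        intro j i β
        cases β <;> simp [N, hsdef] <;> ring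
      simp only [key] at h
      have hm := congrArg (· % s) h
      simp only [Nat.mul_add_mod] at hm
      have hlt : ∀ i : ℕ, i < t - E → ∀ β : Bool, (i + if β then E + t + 1 else 0) < s := by
        intro i hi β; split_ifs <;> omega
      rw [Nat.mod_eq_of_lt (hlt _ hi _), Nat.mod_eq_of_lt (hlt _ hi' _)] at hm
      rw [hm] at h
      have h3 := Nat.eq_of_mul_eq_mul_left (by omega) (Nat.add_right_cancel h)
      have hβ : β = β' := by
        cases β <;> cases β' <;> simp at hm ⊢ <;> omega
      subst hβ
      have : i = i' := Fin.ext (Nat.add_right_cancel hm)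
      have : j = j' := Fin.ext (Nat.add_right_cancel h3)
      simp [*])
    have hH' : (∑ k, C (c k) * e k).degree = ⊥ := by
      rw [degree_eq_bot]; exact hH
    rw [hH'] at hdeg
    have := (Finset.sup_eq_bot_iff _ _).mp hdeg.symm k (Finset.mem_univ _)
    simpa [he0 k] using this
  have hHdeg : 2 * H.natDegree ≤ s ^ 2 + 4 * (2 * E + 1) * s := by
    have h1 : H.natDegree ≤ s * (t + E) + (t - E) + (t + 1) * (2 * E + 1) := by
      refine natDegree_sum_le_of_forall_le _ _ ?_
      rintro ⟨j, i, β⟩ -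
      refine (natDegree_C_mul_le _ _).trans ?_
      rw [hedeg]
      have h2 : N β ≤ t + 1 := by simp only [N]; split_ifs <;> omega
      have h3 : N β * (2 * E + 1) ≤ (t + 1) * (2 * E + 1) := Nat.mul_le_mul_right _ h2
      have h4 : s * j ≤ s * (t + E) := Nat.mul_le_mul_left _ (by omega)
      have := i.2
      simp only
      omega
    have h5 : t - E ≤ t := Nat.sub_le _ _
    rw [hsdef] at h1 ⊢
    nlinarith
  refine le_trans (Nat.mul_le_mul_left 2 ?_) hHdeg
  refine (Finset.card_le_card (t := H.roots.toFinset) ?_).trans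
    ((Multiset.toFinset_card_le _).trans (card_roots' _))
  intro x hx
  rw [Finset.mem_filter] at hx
  rw [Multiset.mem_toFinset, mem_roots hH0, IsRoot.def]
  have hx' : x ^ (s ^ 2) = x := by rw [← hq]; exact FiniteField.pow_card x
  have h1 : (H.eval x) ^ s = (δ c).eval x := by
    simp only [H, δ, eval_finsetSum]
    conv_lhs => rw [hs, sum_pow_char_pow, ← hs]
    refine Finset.sum_congr rfl ?_
    rintro ⟨j, i, β⟩ -
    simp only [e, eval_mul, eval_C, eval_pow, eval_X, mul_pow]
    congr 1
    have h2 : (x ^ (s * j + i : ℕ)) ^ s = x ^ (j + s * i : ℕ) := by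
      rw [← pow_mul, show (s * j + i : ℕ) * s = s ^ 2 * j + s * i by ring, pow_add, pow_mul, hx',
        ← pow_add]
    rw [h2]
    congr 1
    cases β
    · simp [N]
    · simp only [N, if_true]
      rw [← hx.2, ← pow_add, ← pow_mul]
      congr 1
      rw [hsdef]; ring
  rw [hδ, eval_zero] at h1
  exact pow_eq_zero_iff (by omega) |>.mp h1

open Polynomial in
theorem card_minpoly_eq {F K : Type*} [Field F] [Field K] [Fintype K] [Algebra F K]
    {P : F[X]} (hP : Irreducible P) (hm : P.Monic) :
    (Finset.univ.filter fun x : K ↦ minpoly F x = P).card =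
      if P.natDegree ∣ Module.finrank F K then P.natDegree else 0 := by
  have : Finite F := Finite.of_injective _ (algebraMap F K).injective
  have : Module.Finite F K := Module.Finite.of_finite
  have : Fact (Irreducible P) := ⟨hP⟩
  split_ifs with h
  · have hfr : Module.finrank F (AdjoinRoot P) = P.natDegree := by
      rw [(AdjoinRoot.powerBasis hP.ne_zero).finrank, AdjoinRoot.powerBasis_dim]
    have h1 := FiniteField.natCard_algHom_of_finrank_dvd (F := F) (K := AdjoinRoot P) (L := K)
      (by rwa [hfr])
    rw [Nat.card_congr (AdjoinRoot.equiv K F P hP.ne_zero), hfr] at h1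
    rw [← h1, ← Fintype.card_subtype, Fintype.card_eq_nat_card]
    refine Nat.card_congr (Equiv.subtypeEquivRight fun x ↦ ?_)
    rw [mem_aroots]
    constructor
    · rintro rfl
      exact ⟨hP.ne_zero, minpoly.aeval F x⟩
    · rintro ⟨-, hx⟩
      exact (minpoly.eq_of_irreducible_of_monic hP hx hm).symm
  · rw [Finset.card_eq_zero, Finset.filter_eq_empty_iff]
    rintro x - rfl
    exact h (minpoly.degree_dvd (IsIntegral.of_finite F x))

/-- The characteristic polynomial of multiplication by `x` on a field extension. -/
def charpolyOf (F : Type*) {K : Type*} [Field F] [Field K] [Algebra F K] (x : K) : Polynomial F :=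
  minpoly F x ^ (Module.finrank F K / (minpoly F x).natDegree)

open Polynomial in
theorem eval_charpolyOf {F K : Type*} [Field F] [Field K] [Algebra F K] [FiniteDimensional F K]
    (c : F) (x : K) : (charpolyOf F x).eval c = Algebra.norm F (algebraMap F K c - x) := by
  have hx : IsIntegral F x := IsIntegral.of_finite F x
  have hn : Module.finrank F K / (minpoly F x).natDegree =
      Module.finrank (IntermediateField.adjoin F {x}) K := by
    rw [← IntermediateField.adjoin.finrank hx, ← Module.finrank_mul_finrank F
      (IntermediateField.adjoin F {x}) K, Nat.mul_div_cancel_left _ Module.finrank_pos]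
  let g := IntermediateField.AdjoinSimple.gen F x
  have h1 : algebraMap F K c - x =
      algebraMap (IntermediateField.adjoin F {x}) K (algebraMap F _ c - g) := by
    simp [g]
  rw [charpolyOf, eval_pow, hn, h1,
    ← Algebra.norm_norm (R := F) (S := IntermediateField.adjoin F {x}), Algebra.norm_algebraMap,
    map_pow]
  congr 1
  have h2 := charpoly_leftMulMatrix (IntermediateField.adjoin.powerBasis hx)
  rw [Algebra.leftMulMatrix_apply, LinearMap.charpoly_toMatrix,
    IntermediateField.adjoin.powerBasis_gen, IntermediateField.minpoly_gen] at h2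
  rw [← h2, LinearMap.eval_charpoly, Algebra.norm_apply]
  congr 1
  ext1 y
  simp [g, Algebra.smul_def]

open Polynomial in
theorem nextCoeff_charpolyOf {F K : Type*} [Field F] [Field K] [Algebra F K]
    [FiniteDimensional F K] (x : K) : (charpolyOf F x).nextCoeff = -Algebra.trace F K x := by
  have hx : IsIntegral F x := IsIntegral.of_finite F x
  have hn : Module.finrank F K / (minpoly F x).natDegree =
      Module.finrank (IntermediateField.adjoin F {x}) K := by
    rw [← IntermediateField.adjoin.finrank hx, ← Module.finrank_mul_finrank F
      (IntermediateField.adjoin F {x}) K, Nat.mul_div_cancel_left _ Module.finrank_pos]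
  have h2 := (IntermediateField.adjoin.powerBasis hx).trace_gen_eq_nextCoeff_minpoly
  rw [IntermediateField.adjoin.powerBasis_gen, IntermediateField.minpoly_gen] at h2
  rw [charpolyOf, (minpoly.monic hx).nextCoeff_pow, hn, trace_eq_trace_adjoin, h2, smul_neg,
    neg_neg]

theorem sum_pow_sub_self {p : ℕ} [Fact p.Prime] {K : Type*} [Field K] [Fintype K]
    [Algebra (ZMod p) K] {ψ : AddChar (ZMod p) ℂ} (hψ : ψ.IsPrimitive) (G : K → ℂ) :
    ∑ z : K, G (z ^ p - z) =
      ∑ a : ZMod p, ∑ x : K, G x * ψ (a * Algebra.trace (ZMod p) K x) := by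
  have hp : p.Prime := Fact.out
  have : CharP K p := charP_of_injective_algebraMap (algebraMap (ZMod p) K).injective p
  let f : K →+ K := (frobenius K p).toAddMonoidHom - AddMonoidHom.id K
  have hf : ∀ z, f z = z ^ p - z := fun z ↦ by simp [f, frobenius_def]
  let T : K →+ ZMod p := (Algebra.trace (ZMod p) K).toAddMonoidHom
  have hT : ∀ x, T x = Algebra.trace (ZMod p) K x := fun _ ↦ rfl
  have hTsurj : Function.Surjective T := Algebra.trace_surjective (ZMod p) K
  have hle : f.range ≤ T.ker := by
    rintro _ ⟨z, rfl⟩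
    rw [AddMonoidHom.mem_ker, hf, map_sub, hT, hT, sub_eq_zero]
    have := Algebra.trace_eq_of_algEquiv (FiniteField.frobeniusAlgEquiv (ZMod p) K p) z
    simpa using this
  have hker : Nat.card f.ker ≤ p := by
    have hX : (Polynomial.X ^ p - Polynomial.X : Polynomial K) ≠ 0 :=
      FiniteField.X_pow_card_sub_X_ne_zero K hp.one_lt
    rw [← FiniteField.X_pow_card_sub_X_natDegree_eq K hp.one_lt]
    refine le_trans ?_ ((Multiset.toFinset_card_le _).trans (Polynomial.card_roots' _))
    rw [← Fintype.card_eq_nat_card, Fintype.card_subtype]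
    refine Finset.card_le_card fun z hz ↦ ?_
    rw [Finset.mem_filter, AddMonoidHom.mem_ker, hf] at hz
    rw [Multiset.mem_toFinset, Polynomial.mem_roots hX]
    simpa using hz.2
  have hTi : T.ker.index = p := by
    rw [AddSubgroup.index_ker, AddMonoidHom.range_eq_top.mpr hTsurj]
    simp
  have hfi : f.range.index = Nat.card f.ker := AddSubgroup.index_range
  have hdvd : p ∣ Nat.card f.ker := by
    rw [← hfi, ← hTi]; exact AddSubgroup.index_dvd_of_le hle
  have hkp : Nat.card f.ker = p := le_antisymm hker (Nat.le_of_dvd Nat.card_pos hdvd)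
  have hrange : f.range = T.ker := by
    have h1 := T.ker.card_mul_index
    have h2 := f.range.card_mul_index
    rw [hTi] at h1
    rw [hfi, hkp] at h2
    exact AddSubgroup.eq_of_le_of_card_ge hle
      (Nat.le_of_mul_le_mul_right (h1.trans h2.symm).le hp.pos)
  have hfib : ∀ x, ((Finset.univ.filter fun z ↦ f z = x).card : ℂ) =
      ∑ a : ZMod p, ψ (a * T x) := by
    intro x
    rw [AddChar.sum_mulShift _ hψ, ZMod.card]
    by_cases hx : T x = 0
    · rw [if_pos hx]
      have hx' : x ∈ f.range := by rw [hrange]; exact hx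
      rw [AddMonoidHom.card_fiber_eq_of_mem_range f hx' (Set.mem_range.mpr ⟨0, map_zero f⟩),
        ← hkp, ← Fintype.card_subtype, Fintype.card_eq_nat_card]
      rfl
    · rw [if_neg hx]
      have : x ∉ f.range := by rw [hrange]; exact hx
      simp only [Nat.cast_zero, Nat.cast_eq_zero, Finset.card_eq_zero,
        Finset.filter_eq_empty_iff]
      rintro z - rfl
      exact this ⟨z, rfl⟩
  rw [Finset.sum_comm]
  simp_rw [← Finset.mul_sum, ← hT, ← hfib, ← hf]
  rw [← Finset.sum_fiberwise Finset.univ f]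
  refine Finset.sum_congr rfl fun x _ ↦ ?_
  rw [Finset.sum_congr rfl (g := fun _ ↦ G x), Finset.sum_const, nsmul_eq_mul, mul_comm]
  intro z hz
  rw [(Finset.mem_filter.mp hz).2]

open Polynomial in
theorem abs_sum_quadraticChar_norm_eval_le {p m : ℕ} [Fact p.Prime] (hp : p ≠ 2) {K : Type*}
    [Field K] [Fintype K] [Algebra (ZMod p) K] (hK : Fintype.card K = (p ^ m) ^ 2) (F : K[X])
    {E : ℕ} (hF : F.natDegree = 2 * E + 1) (hm : 4 * E ^ 2 + 8 * E + 4 < p ^ m) :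
    |∑ z : K, quadraticChar (ZMod p) (Algebra.norm (ZMod p) (F.eval z))|
      ≤ 5 * (2 * E + 1) * (p ^ m : ℕ) := by
  have hpp : p.Prime := Fact.out
  have : CharP K p := charP_of_injective_algebraMap (algebraMap (ZMod p) K).injective p
  obtain ⟨t, ht⟩ : Odd (p ^ m) := (hpp.odd_of_ne_two hp).pow
  obtain ⟨u, hu⟩ := hpp.odd_of_ne_two hp
  rw [ht] at hm hK ⊢
  have hF0 : F ≠ 0 := by rintro rfl; simp at hF
  have h1 := two_mul_card_eval_pow_eq_le p m ht.symm hK F hF (by omega) 1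
  have h2 := two_mul_card_eval_pow_eq_le p m ht.symm hK F hF (by omega) (-1)
  have hexp : (Nat.card K - 1) / (Nat.card (ZMod p) - 1) * u = 2 * t ^ 2 + 2 * t := by
    rw [Nat.card_eq_fintype_card, hK, Nat.card_eq_fintype_card, ZMod.card]
    have hd : (p - 1) ∣ (2 * t + 1) ^ 2 - 1 := by
      rw [← ht, ← pow_mul]; simpa using Nat.sub_dvd_pow_sub_pow p 1 (m * 2)
    obtain ⟨w, hw⟩ := hd
    rw [hw]
    have : p - 1 = 2 * u := by omega
    have hu0 : 0 < 2 * u := by have := hpp.two_le; omega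
    rw [this] at hw ⊢
    rw [Nat.mul_div_cancel_left _ hu0]
    have : (2 * t + 1) ^ 2 - 1 = 4 * t ^ 2 + 4 * t := by
      rw [show (2 * t + 1) ^ 2 = 4 * t ^ 2 + 4 * t + 1 by ring]; rfl
    nlinarith
  have hchar : ringChar (ZMod p) ≠ 2 := by rwa [ZMod.ringChar_zmod_n]
  have hχ : ∀ y : K, algebraMap (ZMod p) K (quadraticChar (ZMod p) (Algebra.norm (ZMod p) y) : ℤ)
      = y ^ (2 * t ^ 2 + 2 * t) := by
    intro y
    rw [quadraticChar_eq_pow_of_char_ne_two' hchar, map_pow, FiniteField.algebraMap_norm_eq_pow,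
      ← pow_mul, ← hexp, ZMod.card]
    congr 2
    omega
  let χ : K → ℤ := fun z ↦ quadraticChar (ZMod p) (Algebra.norm (ZMod p) (F.eval z))
  let A : ℤ → Finset K := fun ε ↦ Finset.univ.filter fun z ↦ χ z = ε
  have hA : ∀ ε : ℤ, (A ε).card ≤
      (Finset.univ.filter fun x : K ↦ F.eval x ^ (2 * t ^ 2 + 2 * t) = (ε : K)).card := by
    intro ε
    apply Finset.card_le_card
    intro z hz
    simp only [A, Finset.mem_filter, Finset.mem_univ, true_and, χ] at hz ⊢
    rw [← hχ, hz]
    simp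
  have hA1 := hA 1
  have hA2 := hA (-1)
  push_cast at hA1 hA2
  have hA0 : (A 0).card ≤ 2 * E + 1 := by
    rw [← hF]
    refine (Finset.card_le_card (t := F.roots.toFinset) ?_).trans
      ((Multiset.toFinset_card_le _).trans (card_roots' _))
    intro z hz
    simp only [A, Finset.mem_filter, Finset.mem_univ, true_and, χ] at hz
    rw [quadraticChar_eq_zero_iff, Algebra.norm_eq_zero_iff] at hz
    rw [Multiset.mem_toFinset, mem_roots hF0]
    exact hz
  have htri : ∀ z, χ z = 0 ∨ χ z = 1 ∨ χ z = -1 := fun z ↦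
    quadraticChar_isQuadratic (ZMod p) _
  have hsum : ∑ z, χ z = (A 1).card - (A (-1)).card := by
    simp only [A, Finset.card_filter]
    push_cast
    rw [← Finset.sum_sub_distrib]
    refine Finset.sum_congr rfl fun z _ ↦ ?_
    rcases htri z with h | h | h <;> simp [h]
  have htot : Fintype.card K = (A 0).card + (A 1).card + (A (-1)).card := by
    rw [← Finset.card_univ, Finset.card_eq_sum_ones]
    simp only [A, Finset.card_filter]
    rw [← Finset.sum_add_distrib, ← Finset.sum_add_distrib]
    refine Finset.sum_congr rfl fun z _ ↦ ?_
    rcases htri z with h | h | h <;> simp [h]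
  change |∑ z, χ z| ≤ _
  rw [hsum, abs_le]
  rw [hK] at htot
  push_cast
  zify at *
  constructor <;> nlinarith

theorem monic_charpolyOf {F K : Type*} [Field F] [Field K] [Algebra F K] [FiniteDimensional F K]
    (x : K) : (charpolyOf F x).Monic :=
  (minpoly.monic (IsIntegral.of_finite F x)).pow _

theorem natDegree_charpolyOf {F K : Type*} [Field F] [Field K] [Algebra F K]
    [FiniteDimensional F K] (x : K) : (charpolyOf F x).natDegree = Module.finrank F K := by
  rw [charpolyOf, Polynomial.natDegree_pow]
  exact Nat.div_mul_cancel (minpoly.degree_dvd (IsIntegral.of_finite F x))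

/-- The finite set of monic polynomials of degree `d` over a finite field. -/
def monicsOfDegree (F : Type*) [Field F] [Fintype F] (d : ℕ) : Finset (Polynomial F) :=
  Finset.univ.image fun c : Fin d → F ↦
    Polynomial.X ^ d + ∑ i, Polynomial.C (c i) * Polynomial.X ^ (i : ℕ)

open Polynomial in
theorem mem_monicsOfDegree {F : Type*} [Field F] [Fintype F] {d : ℕ} {g : F[X]} :
    g ∈ monicsOfDegree F d ↔ g.Monic ∧ g.natDegree = d := by
  simp only [monicsOfDegree, Finset.mem_image, Finset.mem_univ, true_and]
  constructor
  · rintro ⟨c, rfl⟩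
    have hlt : (∑ i, C (c i) * X ^ (i : ℕ)).degree < (d : WithBot ℕ) := by
      refine lt_of_le_of_lt (degree_sum_le _ _) ?_
      rw [Finset.sup_lt_iff (WithBot.bot_lt_coe _)]
      intro i _
      exact (degree_C_mul_X_pow_le _ _).trans_lt (by exact_mod_cast i.2)
    refine ⟨monic_X_pow_add hlt, ?_⟩
    rw [natDegree_eq_of_degree_eq (degree_add_eq_left_of_degree_lt (by rwa [degree_X_pow])),
      natDegree_X_pow]
  · rintro ⟨hg, rfl⟩
    refine ⟨fun i ↦ g.coeff i, ?_⟩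
    conv_rhs => rw [hg.as_sum]
    rw [Finset.sum_range]

open Polynomial UniqueFactorizationMonoid in
theorem sum_card_charpolyOf_dvd {F : Type*} [Field F] (K : ℕ → Type*)
    [∀ j, Field (K j)] [∀ j, Fintype (K j)] [∀ j, Algebra F (K j)]
    (hK : ∀ j, 0 < j → Module.finrank F (K j) = j) {g : F[X]} (hg : g.Monic) :
    ∑ j ∈ Finset.Icc 1 g.natDegree,
      (Finset.univ.filter fun x : K j ↦ charpolyOf F x ∣ g).card = g.natDegree := by
  have hg0 := hg.ne_zero
  have hfin : ∀ j, FiniteDimensional F (K j) := fun j ↦ Module.Finite.of_finite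
  have hfac : ∀ P, P ∈ normalizedFactors g ↔ Irreducible P ∧ P.Monic ∧ P ∣ g := by
    intro P
    rw [mem_normalizedFactors_iff' hg0]
    constructor
    · rintro ⟨h1, h2, h3⟩
      exact ⟨h1, h2 ▸ monic_normalize h1.ne_zero, h3⟩
    · rintro ⟨h1, h2, h3⟩
      exact ⟨h1, h2.normalize_eq_self, h3⟩
  have hpow : ∀ P ∈ normalizedFactors g, ∀ t : ℕ,
      P ^ t ∣ g ↔ t ≤ (normalizedFactors g).count P := by
    intro P hP t
    have h := (hfac P).mp hP
    rw [pow_dvd_iff_le_emultiplicity, emultiplicity_eq_count_normalizedFactors h.1 hg0,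
      h.2.1.normalize_eq_self, Nat.cast_le]
  have hdeg : g.natDegree = ∑ P ∈ (normalizedFactors g).toFinset,
      (normalizedFactors g).count P * P.natDegree := by
    conv_lhs => rw [← hg.normalize_eq_self, ← prod_normalizedFactors_eq hg0]
    rw [natDegree_multiset_prod_of_monic _ fun P hP ↦ ((hfac P).mp hP).2.1,
      Finset.sum_multiset_map_count]
    simp
  have hcount : ∀ j ∈ Finset.Icc 1 g.natDegree,
      (Finset.univ.filter fun x : K j ↦ charpolyOf F x ∣ g).card =
      ∑ P ∈ (normalizedFactors g).toFinset,
        if P.natDegree ∣ j ∧ P ^ (j / P.natDegree) ∣ g then P.natDegree else 0 := by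
    intro j hj
    have hj0 : 0 < j := (Finset.mem_Icc.mp hj).1
    rw [Finset.card_eq_sum_card_fiberwise (f := fun x ↦ minpoly F x)
      (t := (normalizedFactors g).toFinset)]
    · refine Finset.sum_congr rfl fun P hP ↦ ?_
      have hP' := (hfac P).mp (Multiset.mem_toFinset.mp hP)
      have hc := card_minpoly_eq (K := K j) hP'.1 hP'.2.1
      rw [hK j hj0] at hc
      rw [Finset.filter_filter]
      by_cases hd : P ^ (j / P.natDegree) ∣ g
      · simp only [hd, and_true]
        rw [← hc]
        congr 1
        refine Finset.filter_congr fun x _ ↦ and_iff_right_of_imp ?_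
        rintro rfl
        rwa [charpolyOf, hK j hj0]
      · simp only [hd, and_false, if_false]
        rw [Finset.card_eq_zero, Finset.filter_eq_empty_iff]
        rintro x - ⟨h1, rfl⟩
        rw [charpolyOf, hK j hj0] at h1
        exact hd h1
    · intro x hx
      have hx' := (Finset.mem_filter.mp hx).2
      have hi : IsIntegral F x := IsIntegral.of_finite F x
      rw [Finset.mem_coe, Multiset.mem_toFinset, hfac]
      refine ⟨minpoly.irreducible hi, minpoly.monic hi, (dvd_pow_self _ ?_).trans hx'⟩
      exact (Nat.div_pos (Nat.le_of_dvd Module.finrank_pos (minpoly.degree_dvd hi))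
        (minpoly.natDegree_pos hi)).ne'
  rw [Finset.sum_congr rfl hcount, Finset.sum_comm]
  conv_rhs => rw [hdeg]
  refine Finset.sum_congr rfl fun P hP ↦ ?_
  have hPm := Multiset.mem_toFinset.mp hP
  have hP' := (hfac P).mp hPm
  have he : 0 < P.natDegree := hP'.1.natDegree_pos
  rw [← Finset.sum_filter, Finset.sum_const, smul_eq_mul]
  congr 1
  trans (Finset.Icc 1 ((normalizedFactors g).count P)).card
  swap
  · simp
  symm
  refine Finset.card_bij (fun t _ ↦ t * P.natDegree) ?_ ?_ ?_
  · intro t ht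
    rw [Finset.mem_Icc] at ht
    have hdv := (hpow P hPm t).mpr ht.2
    rw [Finset.mem_filter, Finset.mem_Icc, Nat.mul_div_cancel _ he]
    refine ⟨⟨Nat.mul_pos ht.1 he, ?_⟩, Dvd.intro_left _ rfl, hdv⟩
    rw [← natDegree_pow]
    exact natDegree_le_of_dvd hdv hg0
  · intro t _ t' _ h
    exact Nat.eq_of_mul_eq_mul_right he h
  · intro j hj
    rw [Finset.mem_filter, Finset.mem_Icc] at hj
    refine ⟨j / P.natDegree, ?_, Nat.div_mul_cancel hj.2.1⟩
    rw [Finset.mem_Icc, ← hpow P hPm]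
    exact ⟨Nat.div_pos (Nat.le_of_dvd hj.1.1 hj.2.1) he, hj.2.2⟩

open Polynomial in
theorem sum_monicsOfDegree_filter_dvd {F : Type*} [Field F] [Fintype F] {Λ : F[X] → ℂ}
    (hΛ : ∀ f g, f.Monic → g.Monic → Λ (f * g) = Λ f * Λ g) {h : F[X]} (hh : h.Monic) {d : ℕ}
    (hd : h.natDegree ≤ d) :
    ∑ g ∈ (monicsOfDegree F d).filter (h ∣ ·), Λ g =
      Λ h * ∑ g ∈ monicsOfDegree F (d - h.natDegree), Λ g := by
  rw [Finset.mul_sum]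
  symm
  refine Finset.sum_bij (fun g _ ↦ h * g) ?_ ?_ ?_ ?_
  · intro g hg
    rw [mem_monicsOfDegree] at hg
    rw [Finset.mem_filter, mem_monicsOfDegree, hh.natDegree_mul hg.1, hg.2]
    exact ⟨⟨hh.mul hg.1, by omega⟩, dvd_mul_right _ _⟩
  · intro g _ g' _ hgg
    exact mul_left_cancel₀ hh.ne_zero hgg
  · rintro g hg
    rw [Finset.mem_filter, mem_monicsOfDegree] at hg
    obtain ⟨⟨hg1, hg2⟩, k, rfl⟩ := hg
    have hk : k.Monic := hh.of_mul_monic_left hg1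
    rw [hh.natDegree_mul hk] at hg2
    exact ⟨k, mem_monicsOfDegree.mpr ⟨hk, by omega⟩, rfl⟩
  · intro g hg
    exact (hΛ _ _ hh (mem_monicsOfDegree.mp hg).1).symm

/-- The logarithmic derivative of the Euler product of a completely multiplicative function on
monic polynomials. -/
theorem mul_sum_monicsOfDegree {F : Type*} [Field F] [Fintype F] (K : ℕ → Type*)
    [∀ j, Field (K j)] [∀ j, Fintype (K j)] [∀ j, Algebra F (K j)]
    (hK : ∀ j, 0 < j → Module.finrank F (K j) = j) {Λ : Polynomial F → ℂ}
    (hΛ : ∀ f g, f.Monic → g.Monic → Λ (f * g) = Λ f * Λ g) (d : ℕ) :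
    d * ∑ g ∈ monicsOfDegree F d, Λ g = ∑ j ∈ Finset.Icc 1 d,
      (∑ x : K j, Λ (charpolyOf F x)) * ∑ g ∈ monicsOfDegree F (d - j), Λ g := by
  have hfin : ∀ j, FiniteDimensional F (K j) := fun j ↦ Module.Finite.of_finite
  have h1 : ∀ j ∈ Finset.Icc 1 d, (∑ x : K j, Λ (charpolyOf F x)) *
      ∑ g ∈ monicsOfDegree F (d - j), Λ g = ∑ g ∈ monicsOfDegree F d,
        ((Finset.univ.filter fun x : K j ↦ charpolyOf F x ∣ g).card : ℂ) * Λ g := by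
    intro j hj
    rw [Finset.mem_Icc] at hj
    have hdeg : ∀ x : K j, (charpolyOf F x).natDegree = j := fun x ↦ by
      rw [natDegree_charpolyOf, hK j hj.1]
    rw [Finset.sum_mul]
    have h2 : ∀ x : K j, Λ (charpolyOf F x) * ∑ g ∈ monicsOfDegree F (d - j), Λ g =
        ∑ g ∈ monicsOfDegree F d, if charpolyOf F x ∣ g then Λ g else 0 := by
      intro x
      rw [← Finset.sum_filter, sum_monicsOfDegree_filter_dvd hΛ (monic_charpolyOf x)
        (by rw [hdeg]; exact hj.2), hdeg]
    simp_rw [h2]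
    rw [Finset.sum_comm]
    refine Finset.sum_congr rfl fun g _ ↦ ?_
    rw [← Finset.sum_filter, Finset.sum_const, nsmul_eq_mul]
  rw [Finset.sum_congr rfl h1, Finset.sum_comm, Finset.mul_sum]
  refine Finset.sum_congr rfl fun g hg ↦ ?_
  rw [mem_monicsOfDegree] at hg
  rw [← Finset.sum_mul, ← Nat.cast_sum, ← hg.2, sum_card_charpolyOf_dvd K hK hg.1]

theorem exists_neg_sum_pow_eq {A T : ℕ → ℂ} {N : ℕ} (hA0 : A 0 = 1) (hA : ∀ d, N < d → A d = 0)
    (hAS : ∀ d, d * A d = ∑ j ∈ Finset.Icc 1 d, T j * A (d - j)) :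
    ∃ w : Fin N → ℂ, ∀ n, 0 < n → T n = -∑ i, w i ^ n := by
  let Q : Polynomial ℂ := Polynomial.X ^ N +
    ∑ i : Fin N, Polynomial.C (A (N - i)) * Polynomial.X ^ (i : ℕ)
  have hlt : (∑ i : Fin N, Polynomial.C (A (N - i)) * Polynomial.X ^ (i : ℕ)).degree
      < (N : WithBot ℕ) := by
    refine lt_of_le_of_lt (Polynomial.degree_sum_le _ _) ?_
    rw [Finset.sup_lt_iff (WithBot.bot_lt_coe _)]
    intro i _
    exact (Polynomial.degree_C_mul_X_pow_le _ _).trans_lt (by exact_mod_cast i.2)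
  have hQm : Q.Monic := Polynomial.monic_X_pow_add hlt
  have hQd : Q.natDegree = N := by
    rw [Polynomial.natDegree_eq_of_degree_eq (Polynomial.degree_add_eq_left_of_degree_lt
      (by rwa [Polynomial.degree_X_pow])), Polynomial.natDegree_X_pow]
  have hcoeff : ∀ d ≤ N, Q.coeff (N - d) = A d := by
    intro d hd
    simp only [Q, Polynomial.coeff_add, Polynomial.coeff_X_pow, Polynomial.finsetSum_coeff,
      Polynomial.coeff_C_mul]
    rcases Nat.eq_zero_or_pos d with rfl | hd0
    · rw [Finset.sum_eq_zero]
      · simp [hA0]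
      · intro i _
        rw [if_neg (by omega), mul_zero]
    · rw [if_neg (by omega), zero_add, Finset.sum_eq_single ⟨N - d, by omega⟩]
      · simp [Nat.sub_sub_self hd]
      · intro i _ hi
        rw [if_neg (fun h ↦ hi (Fin.ext h.symm)), mul_zero]
      · simp
  have hroots : Q.roots.card = Q.natDegree := (IsAlgClosed.splits Q).natDegree_eq_card_roots.symm
  obtain ⟨w, hw⟩ : ∃ w : Fin N → ℂ, Multiset.map w Finset.univ.val = Q.roots := by
    have hl : Q.roots.toList.length = N := by rw [Multiset.length_toList, hroots, hQd]
    refine ⟨fun i ↦ Q.roots.toList.get (i.cast hl.symm), ?_⟩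
    rw [Fin.univ_val_map]
    conv_rhs => rw [← Multiset.coe_toList Q.roots]
    congr 1
    refine List.ext_get (by rw [List.length_ofFn, hl]) fun n h1 h2 ↦ ?_
    simp
  have hesymm : ∀ d, A d = (-1) ^ d * MvPolynomial.aeval w (MvPolynomial.esymm (Fin N) ℂ d) := by
    intro d
    rw [MvPolynomial.aeval_esymm_eq_multiset_esymm, hw]
    rcases le_or_gt d N with hd | hd
    · have := Polynomial.coeff_eq_esymm_roots_of_card hroots (k := N - d) (by omega)
      rw [hcoeff d hd, hQm.leadingCoeff, hQd, Nat.sub_sub_self hd, one_mul] at this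
      exact this
    · rw [hA d hd, Multiset.esymm, Multiset.powersetCard_eq_empty _ (by rw [hroots, hQd]; exact hd)]
      simp
  refine ⟨w, fun n ↦ ?_⟩
  induction n using Nat.strong_induction_on with
  | _ n ih =>
  intro hn
  have hnewton := congrArg (MvPolynomial.aeval w) (MvPolynomial.mul_esymm_eq_sum (Fin N) ℂ n)
  have hmul : (n : ℂ) * A n = -∑ j ∈ Finset.Icc 1 n, (∑ i, w i ^ j) * A (n - j) := by
    rw [hesymm]
    simp only [map_mul, map_natCast, map_sum, map_pow, map_neg, map_one, MvPolynomial.psum,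
      MvPolynomial.aeval_X] at hnewton
    rw [mul_left_comm, hnewton, ← mul_assoc, ← pow_add, Odd.neg_one_pow ⟨n, by ring⟩, neg_one_mul]
    congr 1
    symm
    refine Finset.sum_bij (fun j _ ↦ (n - j, j)) ?_ ?_ ?_ ?_
    · intro j hj
      rw [Finset.mem_Icc] at hj
      rw [Finset.mem_filter, Finset.HasAntidiagonal.mem_antidiagonal]
      constructor <;> simp only <;> omega
    · intro j _ j' _ h
      exact (Prod.mk.inj h).2
    · rintro ⟨a, b⟩ hab
      rw [Finset.mem_filter, Finset.HasAntidiagonal.mem_antidiagonal] at hab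
      simp only at hab
      refine ⟨b, Finset.mem_Icc.mpr (by omega), ?_⟩
      rw [← hab.1, Nat.add_sub_cancel]
    · intro j _
      rw [hesymm, mul_comm]
  have hn' : n ∈ Finset.Icc 1 n := Finset.mem_Icc.mpr ⟨hn, le_rfl⟩
  rw [hAS, ← Finset.sum_neg_distrib, ← Finset.add_sum_erase _ _ hn',
    ← Finset.add_sum_erase _ (fun j ↦ -((∑ i, w i ^ j) * A (n - j))) hn',
    Finset.sum_congr rfl (g := fun j ↦ -((∑ i, w i ^ j) * A (n - j))), add_left_inj] at hmul
  · simpa [hA0] using hmul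
  · intro j hj
    rw [Finset.mem_erase, Finset.mem_Icc] at hj
    rw [ih j (by omega) (by omega), neg_mul]

open Polynomial in
theorem sum_monicsOfDegree_eq_zero {F : Type*} [Field F] [Fintype F] [DecidableEq F]
    (hF : ringChar F ≠ 2) {N d : ℕ} (hN : Odd N) (hd : N < d) (c : Fin N → F) (ψ : F → ℂ) :
    ∑ g ∈ monicsOfDegree F d, (∏ i, (quadraticChar F (g.eval (c i)) : ℂ)) * ψ g.nextCoeff = 0 := by
  let χ : F → ℂ := fun x ↦ (quadraticChar F x : ℂ)
  let I : Finset F := Finset.univ.image c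
  let e : F → ℕ := fun v ↦ (Finset.univ.filter fun i ↦ c i = v).card
  have hprod : ∀ g : F[X], ∏ i, (quadraticChar F (g.eval (c i)) : ℂ) =
      ∏ v ∈ I, χ (g.eval v) ^ e v := by
    intro g
    rw [← Finset.prod_fiberwise_of_maps_to (s := Finset.univ) (t := I) (g := c)
      (fun i _ ↦ Finset.mem_image_of_mem _ (Finset.mem_univ i))]
    refine Finset.prod_congr rfl fun v _ ↦ ?_
    rw [Finset.prod_congr rfl (g := fun _ ↦ χ (g.eval v)), Finset.prod_const]
    intro i hi
    rw [(Finset.mem_filter.mp hi).2]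
  obtain ⟨v, hvI, hv⟩ : ∃ v ∈ I, Odd (e v) := by
    by_contra! h
    have h1 : ∑ v ∈ I, e v = N := by
      have := Finset.card_eq_sum_card_fiberwise (s := Finset.univ) (t := I) (f := c)
        (fun i _ ↦ Finset.mem_coe.mpr (Finset.mem_image_of_mem _ (Finset.mem_univ i)))
      rw [← this, Finset.card_univ, Fintype.card_fin]
    have h2 : Even (∑ v ∈ I, e v) :=
      Finset.sum_induction _ Even (fun _ _ ↦ Even.add) (by simp)
        fun v hv ↦ Nat.not_odd_iff_even.mp (h v hv)
    rw [h1] at h2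
    exact Nat.not_even_iff_odd.mpr hN h2
  have hχpow : ∀ x, χ x ^ e v = χ x := by
    intro x
    obtain ⟨k, hk⟩ := hv
    simp only [χ, hk, pow_succ, pow_mul]
    rcases quadraticChar_isQuadratic F x with h | h | h <;> rw [h] <;> simp
  let W : F[X] := ∏ u ∈ I.erase v, (X - C u)
  have hIN : I.card ≤ N := Finset.card_image_le.trans (by simp)
  have hWdeg : W.natDegree + 1 < d := by
    have : W.natDegree = I.card - 1 := by
      rw [natDegree_prod_of_monic _ _ fun u _ ↦ monic_X_sub_C u]
      simp [Finset.card_erase_of_mem hvI]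
    have : 0 < I.card := Finset.card_pos.mpr ⟨v, hvI⟩
    omega
  have hW0 : ∀ u ∈ I.erase v, W.eval u = 0 := by
    intro u hu
    rw [eval_prod]
    exact Finset.prod_eq_zero hu (by simp)
  have hWv : W.eval v ≠ 0 := by
    rw [eval_prod, Finset.prod_ne_zero_iff]
    intro u hu
    simpa [sub_eq_zero] using (Finset.ne_of_mem_erase hu).symm
  have hdegt : ∀ t : F, (C t * W).natDegree + 1 < d := fun t ↦
    lt_of_le_of_lt (Nat.add_le_add_right (natDegree_C_mul_le _ _) 1) hWdeg
  have hmem : ∀ (t : F) (g : F[X]), g ∈ monicsOfDegree F d →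
      g + C t * W ∈ monicsOfDegree F d ∧ (g + C t * W).nextCoeff = g.nextCoeff := by
    intro t g hg
    rw [mem_monicsOfDegree] at hg ⊢
    have hlt : (C t * W).natDegree < g.natDegree := by have := hdegt t; omega
    have hnd : (g + C t * W).natDegree = g.natDegree := natDegree_add_eq_left_of_natDegree_lt hlt
    refine ⟨⟨hg.1.add_of_left (degree_lt_degree hlt), hnd.trans hg.2⟩, ?_⟩
    rw [nextCoeff_of_natDegree_pos (by omega), nextCoeff_of_natDegree_pos (by omega), hnd,
      coeff_add, coeff_eq_zero_of_natDegree_lt (p := C t * W), add_zero]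
    have := hdegt t
    omega
  let Φ : F[X] → ℂ := fun g ↦ (∏ u ∈ I.erase v, χ (g.eval u) ^ e u) * ψ g.nextCoeff
  have hterm : ∀ g, (∏ i, (quadraticChar F (g.eval (c i)) : ℂ)) * ψ g.nextCoeff =
      χ (g.eval v) * Φ g := by
    intro g
    rw [hprod, ← Finset.mul_prod_erase _ _ hvI, hχpow, mul_assoc]
  have hΦ : ∀ (t : F), ∀ g ∈ monicsOfDegree F d, Φ (g + C t * W) = Φ g := by
    intro t g hg
    simp only [Φ]
    rw [(hmem t g hg).2]
    congr 1
    refine Finset.prod_congr rfl fun u hu ↦ ?_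
    rw [eval_add, eval_mul, hW0 u hu, mul_zero, add_zero]
  simp_rw [hterm]
  have hshift : ∀ t : F, ∑ g ∈ monicsOfDegree F d, χ (g.eval v) * Φ g =
      ∑ g ∈ monicsOfDegree F d, χ (g.eval v + t * W.eval v) * Φ g := by
    intro t
    symm
    refine Finset.sum_bij' (fun g _ ↦ g + C t * W) (fun g _ ↦ g + C (-t) * W)
      (fun g hg ↦ (hmem t g hg).1) (fun g hg ↦ (hmem (-t) g hg).1) ?_ ?_ ?_
    · intro g _; simp
    · intro g _; simp
    · intro g hg
      rw [hΦ t g hg]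
      simp
  have hchar : ∀ b : F, ∑ t : F, χ (b + t * W.eval v) = 0 := by
    intro b
    have h1 : ∑ t : F, χ (b + t * W.eval v) = ∑ x : F, χ x :=
      Fintype.sum_equiv ((Equiv.mulRight₀ _ hWv).trans (Equiv.addLeft b)) _ _ fun t ↦ by simp
    rw [h1]
    simp only [χ]
    exact_mod_cast quadraticChar_sum_zero hF
  have hcard : (Fintype.card F : ℂ) * ∑ g ∈ monicsOfDegree F d, χ (g.eval v) * Φ g = 0 := by
    rw [← nsmul_eq_mul, ← Finset.card_univ, ← Finset.sum_const, Finset.sum_congr rfl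
      fun t _ ↦ hshift t, Finset.sum_comm]
    refine Finset.sum_eq_zero fun g _ ↦ ?_
    rw [← Finset.sum_mul, hchar, zero_mul]
  exact (mul_eq_zero.mp hcard).resolve_left (by exact_mod_cast Fintype.card_ne_zero)

open Polynomial in
theorem norm_le_of_norm_sum_pow_le {ι : Type*} [Fintype ι] {w : ι → ℂ} {B R : ℝ} {m₀ : ℕ}
    (hR : 0 < R) (h : ∀ m, m₀ ≤ m → ‖∑ i, w i ^ m‖ ≤ B * R ^ m) (i : ι) : ‖w i‖ ≤ R := by
  let P : ℂ[X] := ∏ v ∈ (Finset.univ.image w).erase (w i), (X - C v)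
  have hPi : P.eval (w i) ≠ 0 := by
    rw [eval_prod, Finset.prod_ne_zero_iff]
    intro v hv
    simpa [sub_eq_zero] using (Finset.ne_of_mem_erase hv).symm
  have hP : ∀ k, w k ≠ w i → P.eval (w k) = 0 := by
    intro k hk
    rw [eval_prod]
    exact Finset.prod_eq_zero (Finset.mem_erase.mpr ⟨hk, Finset.mem_image_of_mem w
      (Finset.mem_univ k)⟩) (by simp)
  let M : ℕ := (Finset.univ.filter fun k ↦ w k = w i).card
  have hM : 0 < M := Finset.card_pos.mpr ⟨i, by simp⟩
  have hsum : ∀ n, ∑ j ∈ Finset.range (P.natDegree + 1), P.coeff j * ∑ k, w k ^ (n + j) =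
      M * P.eval (w i) * w i ^ n := by
    intro n
    have h1 : ∀ k, w k ^ n * P.eval (w k) =
        if w k = w i then P.eval (w i) * w i ^ n else 0 := by
      intro k
      split_ifs with hk
      · rw [hk, mul_comm]
      · rw [hP k hk, mul_zero]
    trans ∑ k, w k ^ n * P.eval (w k)
    · simp_rw [eval_eq_sum_range, Finset.mul_sum]
      rw [Finset.sum_comm]
      refine Finset.sum_congr rfl fun k _ ↦ Finset.sum_congr rfl fun j _ ↦ ?_
      ring
    · simp_rw [h1]
      rw [← Finset.sum_filter, Finset.sum_const, nsmul_eq_mul, mul_assoc]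
  let D : ℝ := ∑ j ∈ Finset.range (P.natDegree + 1), ‖P.coeff j‖ * (B * R ^ j)
  have hbound : ∀ n, m₀ ≤ n → M * ‖P.eval (w i)‖ * ‖w i‖ ^ n ≤ D * R ^ n := by
    intro n hn
    have h2 := congrArg norm (hsum n)
    rw [norm_mul, norm_mul, norm_pow, Complex.norm_natCast] at h2
    rw [← h2, Finset.sum_mul]
    refine (norm_sum_le _ _).trans (Finset.sum_le_sum fun j _ ↦ ?_)
    rw [norm_mul, mul_assoc]
    refine mul_le_mul_of_nonneg_left ((h (n + j) (by omega)).trans_eq ?_) (norm_nonneg _)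
    ring
  by_contra! hlt
  have hc : 0 < M * ‖P.eval (w i)‖ := mul_pos (by exact_mod_cast hM) (norm_pos_iff.mpr hPi)
  obtain ⟨n, hn, hn'⟩ := ((Filter.eventually_ge_atTop m₀).and
    ((tendsto_pow_atTop_atTop_of_one_lt ((one_lt_div hR).mpr hlt)).eventually_gt_atTop
      (D / (M * ‖P.eval (w i)‖)))).exists
  rw [div_pow, div_lt_div_iff₀ hc (pow_pos hR n)] at hn'
  have := hbound n hn
  linarith

open Polynomial in
theorem natDegree_prod_C_sub_X_pow_sub_X {K : Type*} [Field K] {p N : ℕ} (hp : 1 < p)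
    (c : Fin N → K) : (∏ i, (C (c i) - (X ^ p - X))).natDegree = N * p := by
  have h : ∀ i, (C (c i) - (X ^ p - X)).natDegree = p := by
    intro i
    rw [← natDegree_neg, neg_sub, natDegree_sub_C, natDegree_sub_eq_left_of_natDegree_lt]
    · exact natDegree_X_pow p
    · rwa [natDegree_X, natDegree_X_pow]
  rw [natDegree_prod]
  · simp [h]
  · intro i _ h0
    have := h i
    rw [h0, natDegree_zero] at this
    omega

open Polynomial in
theorem norm_sum_prod_quadraticChar_mul_le_of_finrank {p : ℕ} [Fact p.Prime] (K : ℕ → Type*)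
    [∀ j, Field (K j)] [∀ j, Fintype (K j)] [∀ j, Algebra (ZMod p) (K j)]
    (hK : ∀ j, 0 < j → Module.finrank (ZMod p) (K j) = j) (hp : p ≠ 2) {N : ℕ} (hN : Odd N)
    (c : Fin N → ZMod p) {ψ : AddChar (ZMod p) ℂ} (hψ : ψ.IsPrimitive) (a : ZMod p) :
    ‖∑ x : ZMod p, (∏ i, (quadraticChar (ZMod p) (c i - x) : ℂ)) * ψ (a * x)‖ ≤ N * √p := by
  have hpp : p.Prime := Fact.out
  let Λ : ZMod p → (ZMod p)[X] → ℂ := fun a g ↦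
    (∏ i, (quadraticChar (ZMod p) (g.eval (c i)) : ℂ)) * ψ (a * g.nextCoeff)
  have hΛ : ∀ a f g, f.Monic → g.Monic → Λ a (f * g) = Λ a f * Λ a g := by
    intro a f g hf hg
    simp only [Λ, eval_mul, map_mul, Int.cast_mul, Finset.prod_mul_distrib, hf.nextCoeff_mul hg,
      mul_add, AddChar.map_add_eq_mul]
    ring
  let A : ZMod p → ℕ → ℂ := fun a d ↦ ∑ g ∈ monicsOfDegree (ZMod p) d, Λ a g
  let T : ZMod p → ℕ → ℂ := fun a j ↦ ∑ x : K j, Λ a (charpolyOf (ZMod p) x)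
  have hAS : ∀ a d, d * A a d = ∑ j ∈ Finset.Icc 1 d, T a j * A a (d - j) := fun a d ↦
    mul_sum_monicsOfDegree K hK (hΛ a) d
  have hA0 : ∀ a, A a 0 = 1 := by
    intro a
    have h1 : monicsOfDegree (ZMod p) 0 = {1} := by
      ext g
      rw [mem_monicsOfDegree, Finset.mem_singleton]
      exact ⟨fun h ↦ h.1.natDegree_eq_zero.mp h.2, by rintro rfl; simp⟩
    simp only [A, h1, Finset.sum_singleton, Λ]
    simp [nextCoeff]
  have hA : ∀ a d, N < d → A a d = 0 := fun a d hd ↦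
    sum_monicsOfDegree_eq_zero (by rwa [ZMod.ringChar_zmod_n]) hN hd c fun y ↦ ψ (a * y)
  choose w hw using fun a ↦ exists_neg_sum_pow_eq (hA0 a) (hA a) (hAS a)
  have hA1 : ∀ a, A a 1 = -∑ i, w a i := by
    intro a
    have := hAS a 1
    simpa [hA0, hw a 1] using this
  have hsum : ∑ x : ZMod p, (∏ i, (quadraticChar (ZMod p) (c i - x) : ℂ)) * ψ (a * x) =
      A (-a) 1 := by
    refine Finset.sum_bij (fun x _ ↦ X - C x) ?_ ?_ ?_ ?_
    · intro x _
      exact mem_monicsOfDegree.mpr ⟨monic_X_sub_C x, natDegree_X_sub_C x⟩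
    · intro x _ y _ h
      simpa using h
    · intro g hg
      obtain ⟨hg1, hg2⟩ := mem_monicsOfDegree.mp hg
      refine ⟨-g.coeff 0, Finset.mem_univ _, ?_⟩
      conv_rhs => rw [hg1.eq_X_add_C hg2]
      simp
    · intro x _
      simp [Λ]
  obtain ⟨E, hE⟩ : Odd (N * p) := hN.mul (hpp.odd_of_ne_two hp)
  have hpow : ∀ m, 4 * E ^ 2 + 8 * E + 4 ≤ m →
      ‖∑ k : ZMod p × Fin N, (w k.1 k.2 ^ 2) ^ m‖ ≤ 5 * (2 * E + 1) * (p : ℝ) ^ m := by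
    intro m hm
    let F : (K (2 * m))[X] := ∏ i, (C (algebraMap (ZMod p) (K (2 * m)) (c i)) - (X ^ p - X))
    have hcard : Fintype.card (K (2 * m)) = (p ^ m) ^ 2 := by
      rw [← FiniteField.pow_finrank_eq_card p, hK _ (by omega), ← pow_mul, mul_comm]
    have h1 := abs_sum_quadraticChar_norm_eval_le hp hcard F
      ((natDegree_prod_C_sub_X_pow_sub_X hpp.one_lt _).trans hE)
      (hm.trans_lt (Nat.lt_pow_self hpp.one_lt))
    have h2 := sum_pow_sub_self hψ (K := K (2 * m)) fun y ↦
      ∏ i, (quadraticChar (ZMod p) (Algebra.norm (ZMod p) (algebraMap (ZMod p) _ (c i) - y)) : ℂ)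
    have h3 : ∀ z, ∏ i, (quadraticChar (ZMod p) (Algebra.norm (ZMod p)
        (algebraMap (ZMod p) (K (2 * m)) (c i) - (z ^ p - z))) : ℂ) =
        (quadraticChar (ZMod p) (Algebra.norm (ZMod p) (F.eval z)) : ℂ) := by
      intro z
      simp only [F, eval_prod, map_prod, Int.cast_prod]
      simp
    simp_rw [h3] at h2
    have h4 : ∑ k : ZMod p × Fin N, (w k.1 k.2 ^ 2) ^ m = -∑ a, T a (2 * m) := by
      rw [Fintype.sum_prod_type, ← Finset.sum_neg_distrib]
      refine Finset.sum_congr rfl fun a _ ↦ ?_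
      rw [hw a _ (by omega), neg_neg]
      simp_rw [pow_mul]
    have h5 : ∑ a, T a (2 * m) =
        ∑ z : K (2 * m), (quadraticChar (ZMod p) (Algebra.norm (ZMod p) (F.eval z)) : ℂ) := by
      rw [h2]
      refine Fintype.sum_equiv (Equiv.neg _) _ _ fun a ↦ Finset.sum_congr rfl fun x _ ↦ ?_
      simp only [Λ, eval_charpolyOf, nextCoeff_charpolyOf, Equiv.neg_apply, mul_neg, neg_mul]
    rw [h4, norm_neg, h5, ← Int.cast_sum, Complex.norm_intCast]
    exact_mod_cast h1
  have hwle : ∀ a i, ‖w a i‖ ≤ √p := by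
    intro a i
    have := norm_le_of_norm_sum_pow_le (w := fun k : ZMod p × Fin N ↦ w k.1 k.2 ^ 2)
      (by exact_mod_cast hpp.pos) hpow (a, i)
    rw [norm_pow] at this
    exact Real.le_sqrt_of_sq_le this
  rw [hsum, hA1, norm_neg]
  refine (norm_sum_le _ _).trans ((Finset.sum_le_sum fun i _ ↦ hwle (-a) i).trans_eq ?_)
  simp

/-- Weil's bound for the sums of a quadratic character of a product of an odd number of linear
forms, twisted by an additive character. -/
theorem norm_sum_prod_quadraticChar_mul_le {p : ℕ} [Fact p.Prime] (hp : p ≠ 2) {N : ℕ} (hN : Odd N)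
    (c : Fin N → ZMod p) {ψ : AddChar (ZMod p) ℂ} (hψ : ψ.IsPrimitive) (a : ZMod p) :
    ‖∑ x : ZMod p, (∏ i, (quadraticChar (ZMod p) (c i - x) : ℂ)) * ψ (a * x)‖ ≤ N * √p := by
  have : ∀ j, Fintype (GaloisField p j) := fun j ↦ Fintype.ofFinite _
  exact norm_sum_prod_quadraticChar_mul_le_of_finrank (GaloisField p)
    (fun j hj ↦ GaloisField.finrank p hj.ne') hp hN c hψ a

theorem norm_sum_Icc_stdAddChar_natCast_mul_le {p : ℕ} [NeZero p] {n : ℕ} (hn : 0 < n)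
    (hnp : n < p) (M : ℕ) : ‖∑ m ∈ Finset.Icc 1 M, ZMod.stdAddChar ((n : ZMod p) * (m : ZMod p))‖ ≤
      p / 2 * ((n : ℝ)⁻¹ + ((p - n : ℕ) : ℝ)⁻¹) := by
  have hp0 : (0 : ℝ) < p := by exact_mod_cast (hn.trans hnp)
  have hn0 : (0 : ℝ) < n := by exact_mod_cast hn
  have hpn : (0 : ℝ) < p - n := sub_pos.mpr (by exact_mod_cast hnp)
  set z : ℂ := ZMod.stdAddChar (n : ZMod p) with hz
  have hterm : ∀ m : ℕ, ZMod.stdAddChar ((n : ZMod p) * (m : ZMod p)) = z ^ m := by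
    intro m
    rw [mul_comm, ← nsmul_eq_mul, AddChar.map_nsmul_eq_pow]
  have hzexp : z = Complex.exp (Complex.I * ((2 * Real.pi * n / p : ℝ) : ℂ)) := by
    have := ZMod.stdAddChar_coe (N := p) n
    rw [Int.cast_natCast] at this
    rw [hz, this]
    congr 1
    push_cast
    ring
  have hznorm : ‖z‖ = 1 := by rw [hzexp, mul_comm, Complex.norm_exp_ofReal_mul_I]
  have hz1 : 4 * (min (n : ℝ) (p - n) / p) ≤ ‖z - 1‖ := by
    rw [hzexp, Complex.norm_exp_I_mul_ofReal_sub_one, Real.norm_eq_abs, abs_mul, abs_two]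
    have h2 : 2 * Real.pi * n / p / 2 = Real.pi * (n / p) := by ring
    have hle : 2 * (min (n : ℝ) (p - n) / p) ≤ Real.sin (Real.pi * (n / p)) := by
      rcases le_total (n : ℝ) (p - n) with h | h
      · rw [min_eq_left h]
        have h3 := Real.mul_le_sin (x := Real.pi * (n / p)) (by positivity) (by
          have : (n : ℝ) / p ≤ 1 / 2 := by rw [div_le_div_iff₀ hp0 two_pos]; linarith
          nlinarith [Real.pi_pos])
        refine le_trans (le_of_eq ?_) h3
        field_simp
      · rw [min_eq_right h]
        have h3 := Real.mul_le_sin (x := Real.pi * ((p - n) / p)) (by positivity) (by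
          have : ((p : ℝ) - n) / p ≤ 1 / 2 := by rw [div_le_div_iff₀ hp0 two_pos]; linarith
          nlinarith [Real.pi_pos])
        rw [← Real.sin_pi_sub, show Real.pi - Real.pi * (n / p) = Real.pi * ((p - n) / p) by
          field_simp]
        refine le_trans (le_of_eq ?_) h3
        field_simp
    rw [h2]
    linarith [le_abs_self (Real.sin (Real.pi * (n / p)))]
  have hmin : 0 < min (n : ℝ) (p - n) := lt_min hn0 hpn
  have hz1pos : 0 < ‖z - 1‖ := lt_of_lt_of_le (by positivity) hz1
  have hsum : (∑ m ∈ Finset.Icc 1 M, z ^ m) * (z - 1) = z * (z ^ M - 1) := by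
    rw [← Finset.Ico_add_one_right_eq_Icc, Finset.sum_Ico_eq_sum_range, ← geom_sum_mul,
      ← mul_assoc, Finset.mul_sum, Nat.add_sub_cancel]
    simp_rw [pow_add, pow_one]
  have h4 : ‖∑ m ∈ Finset.Icc 1 M, z ^ m‖ * ‖z - 1‖ ≤ 2 := by
    rw [← norm_mul, hsum, norm_mul, hznorm, one_mul]
    refine (norm_sub_le _ _).trans ?_
    rw [norm_pow, hznorm, one_pow, norm_one]
    norm_num
  simp_rw [hterm]
  rw [Nat.cast_sub hnp.le]
  have h5 : ‖∑ m ∈ Finset.Icc 1 M, z ^ m‖ * (4 * (min (n : ℝ) (p - n) / p)) ≤ 2 :=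
    (mul_le_mul_of_nonneg_left hz1 (norm_nonneg _)).trans h4
  have h6 : ‖∑ m ∈ Finset.Icc 1 M, z ^ m‖ ≤ p / 2 * (min (n : ℝ) (p - n))⁻¹ := by
    rw [← le_div_iff₀ (by positivity)] at h5
    refine h5.trans_eq ?_
    field_simp
    norm_num
  refine h6.trans (mul_le_mul_of_nonneg_left ?_ (by positivity))
  rcases min_choice (n : ℝ) (p - n) with h | h <;> rw [h]
  · exact le_add_of_nonneg_right (by positivity)
  · exact le_add_of_nonneg_left (by positivity)

theorem sum_norm_sum_Icc_stdAddChar_mul_le {p M : ℕ} [NeZero p] (hM : M ≤ p) :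
    ∑ a : ZMod p, ‖∑ m ∈ Finset.Icc 1 M, ZMod.stdAddChar (a * (m : ZMod p))‖ ≤
      p * (2 + Real.log p) := by
  have hp : 0 < p := NeZero.pos p
  have hrange : ∑ a : ZMod p, ‖∑ m ∈ Finset.Icc 1 M, ZMod.stdAddChar (a * (m : ZMod p))‖ =
      ∑ n ∈ Finset.range p, ‖∑ m ∈ Finset.Icc 1 M, ZMod.stdAddChar ((n : ZMod p) * (m : ZMod p))‖ := by
    refine Finset.sum_bij' (fun a _ ↦ a.val) (fun n _ ↦ (n : ZMod p)) ?_ ?_ ?_ ?_ ?_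
    · exact fun a _ ↦ Finset.mem_range.mpr (ZMod.val_lt a)
    · simp
    · simp
    · exact fun n hn ↦ ZMod.val_cast_of_lt (Finset.mem_range.mp hn)
    · simp
  have hharm : ∑ n ∈ Finset.Icc 1 (p - 1), (n : ℝ)⁻¹ ≤ 1 + Real.log p := by
    have h1 := harmonic_le_one_add_log (p - 1)
    rw [harmonic_eq_sum_Icc] at h1
    push_cast at h1
    refine h1.trans (add_le_add_right ?_ 1)
    rcases Nat.eq_zero_or_pos (p - 1) with h | h
    · rw [h, Nat.cast_zero, Real.log_zero]
      exact Real.log_natCast_nonneg p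
    · exact Real.log_le_log (by exact_mod_cast h) (by exact_mod_cast Nat.sub_le p 1)
  have hreflect : ∑ n ∈ Finset.Icc 1 (p - 1), ((p - n : ℕ) : ℝ)⁻¹ =
      ∑ n ∈ Finset.Icc 1 (p - 1), (n : ℝ)⁻¹ := by
    refine Finset.sum_bij' (fun n _ ↦ p - n) (fun n _ ↦ p - n) ?_ ?_ ?_ ?_ ?_ <;>
      intro n hn <;> simp only [Finset.mem_Icc] at hn ⊢ <;> omega
  have hIco : Finset.Ico 1 p = Finset.Icc 1 (p - 1) := by
    ext n
    rw [Finset.mem_Ico, Finset.mem_Icc]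
    omega
  rw [hrange, Finset.range_eq_Ico, Finset.sum_eq_sum_Ico_succ_bot hp, zero_add, hIco]
  have h0 : ‖∑ m ∈ Finset.Icc 1 M, ZMod.stdAddChar (((0 : ℕ) : ZMod p) * (m : ZMod p))‖ ≤ p := by
    simpa using hM
  have h1 : ∑ n ∈ Finset.Icc 1 (p - 1),
      ‖∑ m ∈ Finset.Icc 1 M, ZMod.stdAddChar ((n : ZMod p) * (m : ZMod p))‖ ≤
        p * (1 + Real.log p) := by
    refine (Finset.sum_le_sum fun n hn ↦ ?_).trans (b := ∑ n ∈ Finset.Icc 1 (p - 1),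
      (p / 2 * ((n : ℝ)⁻¹ + ((p - n : ℕ) : ℝ)⁻¹))) ?_
    · rw [Finset.mem_Icc] at hn
      exact norm_sum_Icc_stdAddChar_natCast_mul_le (by omega) (by omega) M
    · rw [← Finset.mul_sum, Finset.sum_add_distrib, hreflect]
      nlinarith [(Nat.cast_nonneg p : (0 : ℝ) ≤ p)]
  linarith

/-- Completion of an incomplete sum modulo `p`. -/
theorem norm_sum_Icc_le_of_norm_sum_mul_stdAddChar_le {p M : ℕ} [NeZero p] (hM : M ≤ p)
    {f : ZMod p → ℂ} {B : ℝ} (hf : ∀ a, ‖∑ x, f x * ZMod.stdAddChar (a * x)‖ ≤ B) :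
    ‖∑ m ∈ Finset.Icc 1 M, f m‖ ≤ B * (2 + Real.log p) := by
  have hp : (0 : ℝ) < p := by exact_mod_cast NeZero.pos p
  have hB : 0 ≤ B := (norm_nonneg _).trans (hf 0)
  have hcomp : (p : ℂ) * ∑ m ∈ Finset.Icc 1 M, f m = ∑ a : ZMod p,
      (∑ x, f x * ZMod.stdAddChar (-a * x)) *
        ∑ m ∈ Finset.Icc 1 M, ZMod.stdAddChar (a * (m : ZMod p)) := by
    simp_rw [Finset.mul_sum]
    rw [Finset.sum_comm]
    refine Finset.sum_congr rfl fun m _ ↦ ?_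
    simp_rw [Finset.sum_mul]
    rw [Finset.sum_comm]
    have h1 : ∀ x : ZMod p,
        ∑ a, f x * ZMod.stdAddChar (-a * x) * ZMod.stdAddChar (a * (m : ZMod p)) =
        if x = m then (p : ℂ) * f m else 0 := by
      intro x
      have h2 := AddChar.sum_mulShift ((m : ZMod p) - x) (ZMod.isPrimitive_stdAddChar p)
      simp_rw [mul_assoc, ← AddChar.map_add_eq_mul, ← Finset.mul_sum]
      rw [Finset.sum_congr rfl fun a _ ↦ congrArg _ (show -a * x + a * m = a * (m - x) by ring),
        h2, ZMod.card]
      simp only [sub_eq_zero, eq_comm (a := (m : ZMod p))]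
      split_ifs with hx
      · rw [hx, mul_comm]
      · simp
    simp_rw [h1]
    simp
  have h3 : p * ‖∑ m ∈ Finset.Icc 1 M, f m‖ ≤ p * (B * (2 + Real.log p)) := by
    rw [← Complex.norm_natCast, ← norm_mul, hcomp, Complex.norm_natCast]
    refine (norm_sum_le _ _).trans ?_
    simp_rw [norm_mul]
    refine (Finset.sum_le_sum fun a _ ↦ mul_le_mul_of_nonneg_right (hf (-a))
      (norm_nonneg _)).trans ?_
    rw [← Finset.mul_sum]
    nlinarith [mul_le_mul_of_nonneg_left (sum_norm_sum_Icc_stdAddChar_mul_le hM) hB]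
  exact le_of_mul_le_mul_left h3 hp

theorem abs_sum_Icc_pow_sum_quadraticChar_le {p M N : ℕ} [Fact p.Prime] (hp : p ≠ 2) (hN : Odd N)
    (hM : M ≤ p) (h : ℕ) :
    |∑ m ∈ Finset.Icc 1 M, ((∑ j ∈ Finset.Icc 1 h,
      quadraticChar (ZMod p) ((m + j : ℕ) : ZMod p) : ℤ) : ℝ) ^ N| ≤
      h ^ N * (N * √p * (2 + Real.log p)) := by
  have hflip : ∀ m j : ℕ, quadraticChar (ZMod p) ((m + j : ℕ) : ZMod p) =
      quadraticChar (ZMod p) (-1) * quadraticChar (ZMod p) (-(j : ZMod p) - m) := by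
    intro m j
    rw [← map_mul]
    congr 1
    push_cast
    ring
  have hunit : ‖(quadraticChar (ZMod p) (-1) : ℂ) ^ N‖ = 1 := by
    rcases quadraticChar_dichotomy (neg_ne_zero.mpr (one_ne_zero (α := ZMod p))) with h | h <;>
      simp [h]
  have hexp : ∀ m : ℕ, ((∑ j ∈ Finset.Icc 1 h,
      quadraticChar (ZMod p) ((m + j : ℕ) : ZMod p) : ℤ) : ℂ) ^ N =
      (quadraticChar (ZMod p) (-1) : ℂ) ^ N *
        ∑ t ∈ Fintype.piFinset fun _ : Fin N ↦ Finset.Icc 1 h,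
          ∏ i, (quadraticChar (ZMod p) (-(t i : ZMod p) - m) : ℂ) := by
    intro m
    simp_rw [hflip]
    rw [← Finset.prod_univ_sum (fun _ ↦ Finset.Icc 1 h)
      fun _ j ↦ (quadraticChar (ZMod p) (-(j : ZMod p) - m) : ℂ), Finset.prod_const,
      Finset.card_univ, Fintype.card_fin, ← mul_pow, Finset.mul_sum]
    push_cast
    rfl
  rw [← Real.norm_eq_abs, ← Complex.norm_real]
  rw [Complex.ofReal_sum]
  simp_rw [Complex.ofReal_pow, Complex.ofReal_intCast, hexp]
  rw [← Finset.mul_sum, norm_mul, hunit, one_mul, Finset.sum_comm]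
  have hcompl : ∀ t : Fin N → ℕ, ‖∑ m ∈ Finset.Icc 1 M,
      ∏ i, (quadraticChar (ZMod p) (-(t i : ZMod p) - m) : ℂ)‖ ≤ N * √p * (2 + Real.log p) :=
    fun t ↦ norm_sum_Icc_le_of_norm_sum_mul_stdAddChar_le
      (f := fun x ↦ ∏ i, (quadraticChar (ZMod p) (-(t i : ZMod p) - x) : ℂ)) hM
      (norm_sum_prod_quadraticChar_mul_le hp hN _ (ZMod.isPrimitive_stdAddChar p))
  refine (norm_sum_le _ _).trans ((Finset.sum_le_sum fun t _ ↦ hcompl t).trans_eq ?_)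
  rw [Finset.sum_const, Fintype.card_piFinset_const, Nat.card_Icc, Nat.add_sub_cancel,
    nsmul_eq_mul, Nat.cast_pow]

theorem stmt13 (r : ℕ) (hr : 0 < r) :
    ∃ C > (0 : ℝ), ∀ q : ℕ, q.Prime → Odd q →
      ∀ h : ℕ, r ≤ h → h < q → ∀ g : ℝ, 1 ≤ g → g ≤ q →
        |∑ m ∈ Finset.Icc 1 ⌊g⌋₊, ((S h (m : ℝ) q : ℝ)) ^ (2 * r - 1)|
          ≤ C * (h : ℝ) ^ (2 * r - 1) * Real.sqrt q * Real.log q := by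
  have hN : Odd (2 * r - 1) := ⟨r - 1, by omega⟩
  have hN0 : 0 < 2 * r - 1 := by omega
  refine ⟨3 * (2 * r - 1 : ℕ), by positivity, fun q hq hodd h _ _ g _ hgq ↦ ?_⟩
  have : Fact q.Prime := ⟨hq⟩
  have hq2 : q ≠ 2 := by
    rintro rfl
    exact absurd hodd (by decide)
  have hS : ∀ m : ℕ, S h (m : ℝ) q =
      ∑ j ∈ Finset.Icc 1 h, quadraticChar (ZMod q) ((m + j : ℕ) : ZMod q) := by
    intro m
    refine Finset.sum_congr rfl fun j _ ↦ ?_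
    rw [← jacobiSym.legendreSym.to_jacobiSym, legendreSym]
    simp
  simp_rw [hS]
  refine (abs_sum_Icc_pow_sum_quadraticChar_le hq2 hN (Nat.floor_le_of_le hgq) h).trans ?_
  have hlog : 1 ≤ Real.log q := by
    rw [Real.le_log_iff_exp_le (by exact_mod_cast hq.pos)]
    have h3 : (3 : ℝ) ≤ q := by
      exact_mod_cast (show 3 ≤ q by have := hq.two_le; omega)
    linarith [Real.exp_one_lt_d9]
  have hnn : (0 : ℝ) ≤ h ^ (2 * r - 1) * ((2 * r - 1 : ℕ) * √q) := by positivity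
  nlinarith [mul_le_mul_of_nonneg_left (show 2 + Real.log q ≤ 3 * Real.log q by linarith) hnn]
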